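/- arXiv:2509.05480 — 3 statements merged into one kernel-verified Lean document; each statement's English description precedes it below -/
import Mathlib

section
/- Let T : ℂ² → ℂ² be an ℝ-linear map satisfying T(z, 0) = (a₁·conj(z), 0) for all z ∈ ℂ and T(0, z) = (0, a₂·z) for all z ∈ ℂ, where a₁, a₂ ∈ ℂ with a₂ ≠ 0. Let v = (v₁, v₂) and w = (w₁, w₂) be vectors in ℂ² with v₁, v₂, w₁, w₂ all nonzero. Then T does not map the complex line ℂ·v into the complex line ℂ·w, i.e. it is not the case that T(λ·v) ∈ ℂ·w for all λ ∈ ℂ. -/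
/-- An ℝ-linear map of ℂ² that is antilinear on the first coordinate axis and
linear on the second (with nonzero coefficient there) cannot map a complex line
`ℂ·v` (with both coordinates of `v` nonzero) into a complex line `ℂ·w` (with
both coordinates of `w` nonzero). -/
theorem stmt_3 (T : (ℂ × ℂ) →ₗ[ℝ] (ℂ × ℂ)) (a₁ a₂ : ℂ) (ha₂ : a₂ ≠ 0)
    (h1 : ∀ z : ℂ, T (z, 0) = (a₁ * (starRingEnd ℂ z), 0))
    (h2 : ∀ z : ℂ, T (0, z) = (0, a₂ * z))
    (v₁ v₂ w₁ w₂ : ℂ)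
    (hv₁ : v₁ ≠ 0) (hv₂ : v₂ ≠ 0) (hw₁ : w₁ ≠ 0) (hw₂ : w₂ ≠ 0) :
    ¬ (∀ l : ℂ, T (l • ((v₁, v₂) : ℂ × ℂ)) ∈
        Submodule.span ℂ {((w₁, w₂) : ℂ × ℂ)}) := by
  intro h
  have key (l : ℂ) :
      w₂ * (a₁ * starRingEnd ℂ (l * v₁)) = w₁ * (a₂ * (l * v₂)) := by
    obtain ⟨c, hc⟩ := Submodule.mem_span_singleton.mp (h l)
    have hT : T (l • ((v₁, v₂) : ℂ × ℂ)) =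
        (a₁ * starRingEnd ℂ (l * v₁), a₂ * (l * v₂)) := by
      have hsplit : l • ((v₁, v₂) : ℂ × ℂ) = (l * v₁, 0) + (0, l * v₂) := by simp
      rw [hsplit, map_add, h1, h2]
      simp
    rw [hT, Prod.smul_mk, Prod.mk.injEq, smul_eq_mul, smul_eq_mul] at hc
    rw [← hc.1, ← hc.2]
    ring
  have hone := key 1
  have hI := key Complex.I
  simp only [map_mul, one_mul, Complex.conj_I] at hone hI
  have hzero : 2 * Complex.I * (w₁ * (a₂ * v₂)) = 0 := by
    linear_combination -hI - Complex.I * hone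
  simp [Complex.I_ne_zero, hw₁, ha₂, hv₂] at hzero
end

section
/- (Rado's theorem, several variables) Let D ⊆ ℂⁿ be an open set and let f : D → ℂᵐ be a continuous function on D that is holomorphic on the open subset D \ Z, where Z = {z ∈ D : f(z) = 0} is the zero set of f. Then f is holomorphic on all of D. -/
open Metric Set Filter Topology ComplexConjugate

/-- A maximum modulus principle off the zero set of `f`: only the part of the frontier lying on
the sphere matters. -/
theorem norm_le_of_norm_le_sphere_off_zeros {c : ℂ} {r : ℝ} {f g : ℂ → ℂ} {Ω : Set ℂ}
    (hΩ : Ω = ball c r \ {z | f z = 0})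
    (hf : ContinuousOn f (closedBall c r)) (hfd : DifferentiableOn ℂ f Ω)
    (hg : ContinuousOn g (closure Ω)) (hgd : DifferentiableOn ℂ g Ω) {M : ℝ} (hM0 : 0 < M)
    (hM : ∀ z ∈ closure Ω, z ∈ sphere c r → ‖g z‖ ≤ M) {a : ℂ} (ha : a ∈ closure Ω) :
    ‖g a‖ ≤ M := by
  have hsub : Ω ⊆ ball c r := hΩ ▸ sdiff_subset
  have hcl : closure Ω ⊆ closedBall c r := (closure_mono hsub).trans closure_ball_subset_closedBall
  have hopen : IsOpen Ω := by
    have : Ω = ball c r ∩ f ⁻¹' {0}ᶜ := by rw [hΩ]; rfl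
    rw [this]
    exact (hf.mono ball_subset_closedBall).isOpen_inter_preimage isOpen_ball
      isOpen_compl_singleton
  obtain ⟨K, hK⟩ := (isCompact_closedBall c r).exists_bound_of_continuousOn hf
  refine le_on_closure (s := Ω) (f := fun z => ‖g z‖) (g := fun _ => M) ?_ hg.norm
    continuousOn_const ha
  intro z hz
  by_contra! hlt
  have hfz : f z ≠ 0 := (hΩ ▸ hz : z ∈ ball c r \ {z | f z = 0}).2
  have hK0 : 0 ≤ K := (norm_nonneg _).trans (hK z (hcl (subset_closure hz)))
  have hbound (n : ℕ) : ‖g z‖ ^ n * ‖f z‖ ≤ M ^ n * K := by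
    have key := Complex.norm_le_of_forall_mem_frontier_norm_le (U := Ω)
      (f := fun z => g z ^ n * f z) (C := M ^ n * K)
      (isBounded_ball.subset hsub) ⟨(hgd.pow n).mul hfd, (hg.pow n).mul (hf.mono hcl)⟩ ?_
      (subset_closure hz)
    · simpa using key
    · intro w hw
      have hwcl := frontier_subset_closure hw
      rw [norm_mul, norm_pow]
      by_cases hws : w ∈ sphere c r
      · have h1 := hM w hwcl hws
        have h2 := hK w (hcl hwcl)
        gcongr
      · have hfw : f w = 0 := by
          by_contra hfw
          refine (hopen.frontier_eq ▸ hw).2 ?_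
          rw [hΩ]
          exact ⟨(mem_closedBall.1 (hcl hwcl)).lt_of_ne hws, hfw⟩
        rw [hfw, norm_zero, mul_zero]
        positivity
  obtain ⟨n, hn⟩ := pow_unbounded_of_one_lt (K / ‖f z‖) ((one_lt_div hM0).2 hlt)
  rw [div_pow, div_lt_div_iff₀ (norm_pos_iff.2 hfz) (by positivity)] at hn
  linarith [hbound n]

theorem re_le_of_re_le_sphere_off_zeros {c : ℂ} {r : ℝ} {f g : ℂ → ℂ} {Ω : Set ℂ}
    (hΩ : Ω = ball c r \ {z | f z = 0})
    (hf : ContinuousOn f (closedBall c r)) (hfd : DifferentiableOn ℂ f Ω)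
    (hg : ContinuousOn g (closedBall c r)) (hgd : DifferentiableOn ℂ g Ω) {M : ℝ}
    (hM : ∀ z ∈ sphere c r, (g z).re ≤ M) {a : ℂ} (ha : a ∈ closure Ω) :
    (g a).re ≤ M := by
  have hcl : closure Ω ⊆ closedBall c r :=
    (closure_mono (hΩ ▸ sdiff_subset)).trans closure_ball_subset_closedBall
  have := norm_le_of_norm_le_sphere_off_zeros hΩ hf hfd (g := fun z => Complex.exp (g z))
    (hg.mono hcl).cexp hgd.cexp (Real.exp_pos M)
    (fun z _ hz => by simpa [Complex.norm_exp] using hM z hz) ha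
  simpa [Complex.norm_exp] using this

/-- If the center of a disc is a limit of non-zeros of `f`, then the non-zeros of `f` are dense in
the disc of half the radius. -/
theorem ball_half_subset_closure_off_zeros {c : ℂ} {r : ℝ} {f : ℂ → ℂ} {Ω : Set ℂ}
    (hΩ : Ω = ball c r \ {z | f z = 0})
    (hf : ContinuousOn f (closedBall c r)) (hfd : DifferentiableOn ℂ f Ω) (hc : c ∈ closure Ω) :
    ball c (r / 2) ⊆ closure Ω := by
  intro b hb
  by_contra hbΩ
  have hne (z : ℂ) (hz : z ∈ closure Ω) : z - b ≠ 0 :=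
    sub_ne_zero.2 fun h => hbΩ (h ▸ hz)
  rw [mem_ball, dist_eq_norm] at hb
  have hpos : 0 < r - ‖b - c‖ := by linarith [norm_nonneg (b - c)]
  have hd : DifferentiableOn ℂ (fun z => (z - b)⁻¹) (closure Ω) :=
    fun z hz => ((differentiableAt_id.sub_const b).inv (hne z hz)).differentiableWithinAt
  have := norm_le_of_norm_le_sphere_off_zeros hΩ hf hfd hd.continuousOn
    (hd.mono subset_closure) (inv_pos.2 hpos) ?_ hc
  · rw [norm_inv, inv_le_inv₀ (norm_pos_iff.2 (hne c hc)) hpos, norm_sub_rev c b] at this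
    linarith
  · intro z _ hzs
    rw [norm_inv]
    gcongr
    rw [mem_sphere, dist_eq_norm] at hzs
    have := norm_sub_le_norm_sub_add_norm_sub z b c
    linarith

/-- Continuous functions on a circle are uniformly approximated by functions `p + conj q` with `p`
and `q` entire. -/
theorem exists_entire_add_conj_entire_approx {c : ℂ} {r : ℝ} (hr : 0 < r) {g : ℂ → ℂ}
    (hg : ContinuousOn g (sphere c r)) {ε : ℝ} (hε : 0 < ε) :
    ∃ p q : ℂ → ℂ, Differentiable ℂ p ∧ Differentiable ℂ q ∧
      ∀ z ∈ sphere c r, ‖g z - (p z + conj (q z))‖ ≤ ε := by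
  have : Fact (0 < (1 : ℝ)) := ⟨one_pos⟩
  have hmem (x : AddCircle (1 : ℝ)) : c + r * (x.toCircle : ℂ) ∈ sphere c r := by
    rw [mem_sphere, dist_eq_norm, add_sub_cancel_left, norm_mul, Circle.norm_coe]
    simp [hr.le]
  let φ : C(AddCircle (1 : ℝ), ℂ) :=
    ⟨fun x => g (c + r * (x.toCircle : ℂ)), hg.comp_continuous (by
      have := AddCircle.continuous_toCircle (T := (1 : ℝ))
      fun_prop) hmem⟩
  have hφ : φ ∈ closure (Submodule.span ℂ (range (fourier (T := (1 : ℝ)))) : Set _) := by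
    rw [← Submodule.topologicalClosure_coe, span_fourier_closure_eq_top]
    trivial
  obtain ⟨ψ, hψ, hφψ⟩ := Metric.mem_closure_iff.1 hφ ε hε
  have hspan : ∃ p q : ℂ → ℂ, Differentiable ℂ p ∧ Differentiable ℂ q ∧
      ∀ x, ψ x = p (x.toCircle : ℂ) + conj (q (x.toCircle : ℂ)) := by
    clear hφψ
    rw [SetLike.mem_coe] at hψ
    induction hψ using Submodule.span_induction with
    | mem ψ h =>
      obtain ⟨n, rfl⟩ := h
      obtain ⟨k, rfl | rfl⟩ := n.eq_nat_or_neg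
      · exact ⟨fun z => z ^ k, 0, by fun_prop, differentiable_const 0, fun x => by
          simp [fourier_apply, AddCircle.toCircle_nsmul]⟩
      · refine ⟨0, fun z => z ^ k, differentiable_const 0, by fun_prop, fun x => ?_⟩
        rw [fourier_neg]
        simp [fourier_apply, AddCircle.toCircle_nsmul]
    | zero => exact ⟨0, 0, differentiable_const 0, differentiable_const 0, by simp⟩
    | add ψ₁ ψ₂ _ _ h₁ h₂ =>
      obtain ⟨p₁, q₁, hp₁, hq₁, h₁⟩ := h₁
      obtain ⟨p₂, q₂, hp₂, hq₂, h₂⟩ := h₂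
      refine ⟨p₁ + p₂, q₁ + q₂, hp₁.add hp₂, hq₁.add hq₂, fun x => ?_⟩
      simp only [ContinuousMap.add_apply, h₁, h₂, Pi.add_apply, map_add]
      ring
    | smul a ψ _ h =>
      obtain ⟨p, q, hp, hq, h⟩ := h
      refine ⟨a • p, conj a • q, hp.const_smul a, hq.const_smul _, fun x => ?_⟩
      simp [h, mul_add]
  obtain ⟨p, q, hp, hq, h⟩ := hspan
  refine ⟨fun z => p ((z - c) / r), fun z => q ((z - c) / r), by fun_prop, by fun_prop,
    fun z hz => ?_⟩
  have hr' : (r : ℂ) ≠ 0 := by exact_mod_cast hr.ne'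
  have hz1 : (z - c) / r ∈ Submonoid.unitSphere ℂ := by
    rw [mem_sphere, dist_eq_norm] at hz
    simp [Submonoid.unitSphere, hz, abs_of_pos hr, hr.ne']
  obtain ⟨x, hx⟩ := (AddCircle.homeomorphCircle (one_ne_zero (α := ℝ))).surjective ⟨_, hz1⟩
  rw [AddCircle.homeomorphCircle_apply] at hx
  have hx' : (x.toCircle : ℂ) = (z - c) / r := congrArg Subtype.val hx
  have hzx : c + r * (x.toCircle : ℂ) = z := by rw [hx']; field_simp; ring
  have := ((ContinuousMap.dist_apply_le_dist x).trans hφψ.le)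
  rwa [dist_eq_norm, h, hx', show φ x = g z from congrArg g hzx] at this

/-- The mean value property for functions holomorphic off the zero set of `f`. -/
theorem circleAverage_eq_of_holomorphic_off_zeros {c : ℂ} {r : ℝ} (hr : 0 < r) {f g : ℂ → ℂ}
    {Ω : Set ℂ} (hΩ : Ω = ball c r \ {z | f z = 0})
    (hf : ContinuousOn f (closedBall c r)) (hfd : DifferentiableOn ℂ f Ω) (hc : c ∈ closure Ω)
    (hg : ContinuousOn g (closedBall c r)) (hgd : DifferentiableOn ℂ g Ω) :
    Real.circleAverage g c r = g c := by
  have hgs : ContinuousOn g (sphere c r) := hg.mono sphere_subset_closedBall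
  refine eq_of_forall_dist_le fun ε hε => ?_
  obtain ⟨p, q, hp, hq, h⟩ := exists_entire_add_conj_entire_approx hr hgs
    (show 0 < ε / 3 by positivity)
  have re_bound (a b : ℂ) (hab : ∀ w : ℂ, (a * w).re = (b * conj w).re) (ha : ‖a‖ = 1) :
      (a * (g c - (p c + conj (q c)))).re ≤ ε / 3 := by
    have heq (z : ℂ) : (a * (g z - (p z + conj (q z)))).re
        = (a * (g z - p z) - b * q z).re := by
      have := hab (conj (q z))
      simp only [Complex.conj_conj] at this
      rw [Complex.sub_re, ← this, ← Complex.sub_re]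
      ring_nf
    rw [heq]
    refine re_le_of_re_le_sphere_off_zeros hΩ hf hfd
      (g := fun z => a * (g z - p z) - b * q z) ?_ ?_ (fun z hz => ?_) hc
    · have := hp.continuous
      have := hq.continuous
      fun_prop
    · fun_prop
    · rw [← heq]
      refine (Complex.re_le_norm _).trans ?_
      rw [norm_mul, ha, one_mul]
      exact h z hz
  have h1 := re_bound 1 1 (by simp) (by simp)
  have h2 := re_bound (-1) (-1) (by simp) (by simp)
  have h3 := re_bound Complex.I (-Complex.I) (by simp) (by simp)
  have h4 := re_bound (-Complex.I) Complex.I (by simp) (by simp)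
  have hcenter : ‖g c - (p c + conj (q c))‖ ≤ 2 * (ε / 3) := by
    refine (Complex.norm_le_abs_re_add_abs_im _).trans ?_
    simp only [one_mul, neg_mul, Complex.neg_re, Complex.I_mul_re, neg_neg] at h1 h2 h3 h4
    linarith [abs_le.2 ⟨by linarith, h1⟩, abs_le.2 ⟨by linarith, h4⟩]
  have hp' : Real.circleAverage p c r = p c := DiffContOnCl.circleAverage hp.diffContOnCl
  have hq' : Real.circleAverage q c r = q c := DiffContOnCl.circleAverage hq.diffContOnCl
  have hcq : Real.circleAverage (fun z => conj (q z)) c r = conj (q c) := by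
    rw [← hq']
    exact Complex.conjCLE.toContinuousLinearMap.circleAverage_comp_comm
      hq.continuous.continuousOn.circleIntegrable'
  have ip : CircleIntegrable p c r := hp.continuous.continuousOn.circleIntegrable'
  have iq : CircleIntegrable (fun z => conj (q z)) c r :=
    (Complex.continuous_conj.comp hq.continuous).continuousOn.circleIntegrable'
  have ig : CircleIntegrable g c r := hgs.circleIntegrable hr.le
  have havg : ‖Real.circleAverage (fun z => g z - (p z + conj (q z))) c r‖ ≤ ε / 3 := by
    rw [Real.circleAverage, norm_smul]
    have := intervalIntegral.norm_integral_le_of_norm_le_const (a := 0) (b := 2 * Real.pi)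
      (f := fun θ => g (circleMap c r θ) - (p (circleMap c r θ) + conj (q (circleMap c r θ))))
      (C := ε / 3) (fun θ _ => h _ (circleMap_mem_sphere c hr.le θ))
    rw [sub_zero, abs_of_pos Real.two_pi_pos] at this
    rw [norm_inv, Real.norm_of_nonneg Real.two_pi_pos.le, inv_mul_le_iff₀ Real.two_pi_pos]
    linarith
  have ipq : CircleIntegrable (fun z => p z + conj (q z)) c r := ip.add iq
  rw [Real.circleAverage_fun_sub ig ipq, Real.circleAverage_fun_add ip iq, hp', hcq] at havg
  rw [dist_eq_norm]
  calc ‖Real.circleAverage g c r - g c‖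
      = ‖(Real.circleAverage g c r - (p c + conj (q c))) - (g c - (p c + conj (q c)))‖ := by
        congr 1; ring
    _ ≤ ε / 3 + 2 * (ε / 3) := (norm_sub_le _ _).trans (add_le_add havg hcenter)
    _ = ε := by ring

/-- **Radó's theorem** in one variable. -/
theorem differentiableOn_of_differentiableOn_off_zeros {U : Set ℂ} (hU : IsOpen U) {f : ℂ → ℂ}
    (hf : ContinuousOn f U) (hfd : DifferentiableOn ℂ f (U \ {z | f z = 0})) :
    DifferentiableOn ℂ f U := by
  intro c hcU
  apply DifferentiableAt.differentiableWithinAt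
  by_cases hcl : c ∈ closure (U \ {z | f z = 0})
  swap
  · have : f =ᶠ[𝓝 c] fun _ => 0 := by
      filter_upwards [hU.mem_nhds hcU, isClosed_closure.isOpen_compl.mem_nhds hcl] with z hz hz'
      by_contra h
      exact hz' (subset_closure ⟨hz, h⟩)
    exact this.differentiableAt_iff.2 (differentiableAt_const _)
  obtain ⟨r, hr, hrU⟩ := nhds_basis_closedBall.mem_iff.1 (hU.mem_nhds hcU)
  obtain ⟨Ω, hΩ⟩ : ∃ Ω, Ω = ball c r \ {z | f z = 0} := ⟨_, rfl⟩
  have hfB : ContinuousOn f (closedBall c r) := hf.mono hrU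
  have hfΩ : DifferentiableOn ℂ f Ω :=
    hfd.mono (hΩ ▸ sdiff_subset_sdiff_left (ball_subset_closedBall.trans hrU))
  have hopen : IsOpen Ω := by
    have : Ω = ball c r ∩ f ⁻¹' {0}ᶜ := by rw [hΩ]; rfl
    rw [this]
    exact (hfB.mono ball_subset_closedBall).isOpen_inter_preimage isOpen_ball
      isOpen_compl_singleton
  have hcΩ : c ∈ closure Ω := by
    rw [mem_closure_iff_nhds] at hcl ⊢
    intro t ht
    obtain ⟨z, ⟨hzt, hzr⟩, hzU, hz0⟩ := hcl _ (inter_mem ht (ball_mem_nhds c hr))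
    exact ⟨z, hzt, hΩ ▸ ⟨hzr, hz0⟩⟩
  have hsphere : ContinuousOn f (sphere c r) := hfB.mono sphere_subset_closedBall
  let F : ℂ → ℂ := fun w => (2 * Real.pi * Complex.I : ℂ)⁻¹ • ∮ z in C(c, r), (z - w)⁻¹ • f z
  have hF : DifferentiableOn ℂ F (ball c r) := by
    lift r to NNReal using hr.le
    have := (hasFPowerSeriesOn_cauchy_integral (hsphere.circleIntegrable hr.le) hr).differentiableOn
    rwa [Metric.eball_coe] at this
  have hFf : EqOn f F Ω := by
    intro w hw
    have hwb : w ∈ ball c r := (hΩ ▸ hw : w ∈ ball c r \ {z | f z = 0}).1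
    have hdw : ContinuousOn (dslope f w) (closedBall c r) :=
      (continuousOn_dslope (mem_of_superset (isOpen_ball.mem_nhds hwb)
        ball_subset_closedBall)).2 ⟨hfB, hfΩ.differentiableAt (hopen.mem_nhds hw)⟩
    have hdd : DifferentiableOn ℂ (dslope f w) Ω :=
      (Complex.differentiableOn_dslope (hopen.mem_nhds hw)).2 hfΩ
    have hmean := circleAverage_eq_of_holomorphic_off_zeros hr hΩ hfB hfΩ hcΩ
      (g := fun z => (z - c) * dslope f w z) (by fun_prop) (by fun_prop)
    rw [Real.circleAverage_eq_circleIntegral hr.ne', sub_self, zero_mul, smul_eq_zero,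
      or_iff_right (by simp [Real.pi_ne_zero])] at hmean
    have hne (z : ℂ) (hz : z ∈ sphere c r) : z - w ≠ 0 := by
      rintro h
      rw [sub_eq_zero.1 h] at hz
      exact (mem_ball.1 hwb).ne hz
    have hint : (∮ z in C(c, r), ((z - w)⁻¹ • f z - (z - w)⁻¹ • f w)) = 0 := by
      rw [← hmean]
      refine circleIntegral.integral_congr hr.le fun z hz => ?_
      have hzc : z - c ≠ 0 := sub_ne_zero.2 (ne_of_mem_sphere hz hr.ne')
      have hzw := hne z hz
      simp only [smul_eq_mul]
      rw [dslope_of_ne _ (sub_ne_zero.1 hzw), slope_def_field]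
      field_simp
    have hinv : ContinuousOn (fun z => (z - w)⁻¹) (sphere c r) :=
      ContinuousOn.inv₀ (by fun_prop) hne
    have i₁ : CircleIntegrable (fun z => (z - w)⁻¹ • f z) c r :=
      (hinv.smul hsphere).circleIntegrable hr.le
    have i₂ : CircleIntegrable (fun z => (z - w)⁻¹ • f w) c r :=
      (hinv.smul continuousOn_const).circleIntegrable hr.le
    rw [circleIntegral.integral_sub i₁ i₂, sub_eq_zero,
      circleIntegral.integral_smul_const, circleIntegral.integral_sub_inv_of_mem_ball hwb] at hint
    simp only [F]
    rw [hint, inv_smul_smul₀ (by simp [Real.pi_ne_zero])]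
  have hball : ball c (r / 2) ⊆ ball c r := ball_subset_ball (by linarith)
  have hsub := ball_half_subset_closure_off_zeros hΩ hfB hfΩ hcΩ
  have heq : EqOn f F (ball c (r / 2)) := by
    intro z hz
    have hzr := isOpen_ball.mem_nhds (hball hz)
    have : (𝓝[Ω] z).NeBot := mem_closure_iff_nhdsWithin_neBot.1 (hsub hz)
    refine tendsto_nhds_unique_of_eventuallyEq (l := 𝓝[Ω] z) ?_ ?_
      (eventually_mem_nhdsWithin.mono fun _ h => hFf h)
    · exact ((hfB.mono ball_subset_closedBall).continuousAt hzr).tendsto.mono_left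
        nhdsWithin_le_nhds
    · exact (hF.continuousOn.continuousAt hzr).tendsto.mono_left nhdsWithin_le_nhds
  have hc2 : ball c (r / 2) ∈ 𝓝 c := ball_mem_nhds c (half_pos hr)
  exact ((hF.mono hball).differentiableAt hc2).congr_of_eventuallyEq
    (heq.eventuallyEq_of_mem hc2)

/-- Second-order Taylor estimate for a bounded holomorphic function on a disc. -/
theorem norm_sub_sub_deriv_le_of_norm_le {φ : ℂ → ℂ} {R M : ℝ} (hR : 0 < R)
    (hφ : DifferentiableOn ℂ φ (ball 0 R)) (hM : ∀ t ∈ ball (0 : ℂ) R, ‖φ t‖ ≤ M) {t : ℂ}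
    (ht : t ∈ ball 0 R) :
    ‖φ t - φ 0 - t * deriv φ 0‖ ≤ 4 * M * (‖t‖ / R) ^ 2 := by
  have h0 : (0 : ℂ) ∈ ball 0 R := mem_ball_self hR
  have hd0 : DifferentiableAt ℂ φ 0 := hφ.differentiableAt (isOpen_ball.mem_nhds h0)
  have hmaps : MapsTo φ (ball 0 R) (closedBall (φ 0) (2 * M)) := fun s hs => by
    rw [mem_closedBall, dist_eq_norm]
    linarith [norm_sub_le (φ s) (φ 0), hM s hs, hM 0 h0]
  have hderiv : ‖deriv φ 0‖ ≤ 2 * M / R := Complex.norm_deriv_le_div_of_mapsTo_ball hφ hmaps hR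
  have key := Complex.dist_le_mul_div_pow_of_mapsTo_ball_of_isLittleO (n := 1)
    (f := fun s => φ s - s * deriv φ 0) (c := 0) (z := t) (R₁ := R) (R₂ := 4 * M)
    (hφ.sub (differentiableOn_id.mul_const _)) (fun s hs => ?_) ?_ ht
  · simp only [dist_eq_norm, zero_mul, sub_zero] at key
    rwa [sub_right_comm]
  · have h1 := hmaps hs
    rw [mem_closedBall, dist_eq_norm] at h1 ⊢
    have h2 : ‖s * deriv φ 0‖ ≤ 2 * M := by
      rw [norm_mul]
      calc ‖s‖ * ‖deriv φ 0‖ ≤ R * (2 * M / R) := by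
            gcongr
            exact (mem_ball_zero_iff.1 hs).le
        _ = 2 * M := by field_simp
    rw [zero_mul, sub_zero, sub_right_comm]
    linarith [norm_sub_le (φ s - φ 0) (s * deriv φ 0)]
  · have := hd0.hasDerivAt.isLittleO
    simp only [sub_zero, smul_eq_mul, pow_one, zero_mul] at this ⊢
    refine (this.norm_right).congr_left fun s => by ring

/-- A bounded Gateaux-holomorphic function on a ball has a second-order expansion along lines. -/
theorem norm_sub_sub_lineDeriv_le {E : Type*} [NormedAddCommGroup E] [NormedSpace ℂ E]
    {f : E → ℂ} {z : E} {r M : ℝ} (hr : 0 < r) (hM : ∀ w ∈ ball z r, ‖f w‖ ≤ M)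
    (hline : ∀ v : E, DifferentiableOn ℂ (fun t : ℂ => f (z + t • v)) {t | z + t • v ∈ ball z r})
    {v : E} (hv : ‖v‖ < r) :
    ‖f (z + v) - f z - lineDeriv ℂ f z v‖ ≤ 4 * M / r ^ 2 * ‖v‖ ^ 2 := by
  rcases eq_or_ne v 0 with rfl | hv0
  · simp [lineDeriv_zero]
  have hvpos := norm_pos_iff.2 hv0
  have hmem (t : ℂ) (ht : t ∈ ball (0 : ℂ) (r / ‖v‖)) : z + t • v ∈ ball z r := by
    rw [mem_ball_zero_iff, lt_div_iff₀ hvpos] at ht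
    simpa [dist_eq_norm, norm_smul] using ht
  have := norm_sub_sub_deriv_le_of_norm_le (φ := fun t : ℂ => f (z + t • v)) (R := r / ‖v‖)
    (M := M) (by positivity) ((hline v).mono hmem) (fun t ht => hM _ (hmem t ht)) (t := 1)
    (by simpa [one_lt_div hvpos] using hv)
  simp only [one_smul, zero_smul, add_zero, one_mul, norm_one] at this
  refine this.trans_eq ?_
  field_simp

/-- **Osgood's lemma**, in Gateaux form: a continuous function on an open subset of a
finite-dimensional space that is holomorphic along every complex line is holomorphic. -/
theorem differentiableOn_of_continuousOn_of_differentiableOn_lines {E : Type*}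
    [NormedAddCommGroup E] [NormedSpace ℂ E] [FiniteDimensional ℂ E] {U : Set E} (hU : IsOpen U)
    {f : E → ℂ} (hf : ContinuousOn f U)
    (hline : ∀ z v : E, DifferentiableOn ℂ (fun t : ℂ => f (z + t • v)) {t | z + t • v ∈ U}) :
    DifferentiableOn ℂ f U := by
  intro a ha
  apply DifferentiableAt.differentiableWithinAt
  obtain ⟨r, hr, hrU, M, hM⟩ : ∃ r > 0, ball a (2 * r) ⊆ U ∧
      ∃ M, ∀ w ∈ ball a (2 * r), ‖f w‖ ≤ M := by
    have h1 : ∀ᶠ w in 𝓝 a, ‖f w‖ ≤ ‖f a‖ + 1 :=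
      ((hf.continuousAt (hU.mem_nhds ha)).norm.eventually_lt continuousAt_const
        (lt_add_one ‖f a‖)).mono fun _ h => h.le
    obtain ⟨r, hr, h⟩ := Metric.eventually_nhds_iff_ball.1 (h1.and (hU.mem_nhds ha))
    refine ⟨r / 2, half_pos hr, ?_, ‖f a‖ + 1, ?_⟩ <;> rw [mul_div_cancel₀ r two_ne_zero]
    exacts [fun w hw => (h w hw).2, fun w hw => (h w hw).1]
  obtain ⟨C, hC⟩ : ∃ C, ∀ z ∈ ball a r, ∀ v : E, ‖v‖ < r →
      ‖f (z + v) - f z - lineDeriv ℂ f z v‖ ≤ C * ‖v‖ ^ 2 := by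
    refine ⟨4 * M / r ^ 2, fun z hz v hv => ?_⟩
    have hsub : ball z r ⊆ ball a (2 * r) := ball_subset_ball' (by
      linarith [mem_ball.1 hz])
    exact norm_sub_sub_lineDeriv_le hr (fun w hw => hM w (hsub hw))
      (fun v => (hline z v).mono fun t ht => hrU (hsub ht)) hv
  have ha0 : a ∈ ball a r := mem_ball_self hr
  have hquot (v : E) : ∀ᶠ t : ℂ in 𝓝[≠] 0, ∀ z ∈ ball a r,
      ‖(f (z + t • v) - f z) / t - lineDeriv ℂ f z v‖ ≤ C * ‖v‖ ^ 2 * ‖t‖ := by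
    have hsmall : ∀ᶠ t : ℂ in 𝓝[≠] 0, ‖t • v‖ < r := by
      refine (Continuous.tendsto' (by fun_prop) 0 0 (by simp)).eventually_lt_const hr
        |>.filter_mono nhdsWithin_le_nhds
    filter_upwards [hsmall, self_mem_nhdsWithin] with t ht ht0 z hz
    have ht0' : t ≠ 0 := ht0
    have := hC z hz _ ht
    rw [lineDeriv_smul, norm_smul] at this
    have heq : (f (z + t • v) - f z) / t - lineDeriv ℂ f z v
        = (f (z + t • v) - f z - t • lineDeriv ℂ f z v) / t := by
      rw [smul_eq_mul]
      field_simp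
    rw [heq, norm_div, div_le_iff₀ (norm_pos_iff.2 ht0')]
    linarith
  have hcont (v : E) : ContinuousAt (fun z => lineDeriv ℂ f z v) a := by
    refine continuousAt_of_locally_uniform_approx_of_continuousAt fun 𝒱 h𝒱 => ?_
    obtain ⟨ε, hε, hε𝒱⟩ := mem_uniformity_dist.1 h𝒱
    have hlim : ∀ᶠ t : ℂ in 𝓝[≠] 0, C * ‖v‖ ^ 2 * ‖t‖ < ε :=
      (Continuous.tendsto' (by fun_prop) 0 0 (by simp)).eventually_lt_const hε
        |>.filter_mono nhdsWithin_le_nhds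
    have hmem : ∀ᶠ t : ℂ in 𝓝[≠] 0, a + t • v ∈ U :=
      (Continuous.tendsto' (by fun_prop) 0 a (by simp)).eventually_mem (hU.mem_nhds ha)
        |>.filter_mono nhdsWithin_le_nhds
    obtain ⟨t, ht, htε, htU⟩ := ((hquot v).and (hlim.and hmem)).exists
    refine ⟨ball a r, ball_mem_nhds a hr, fun z => (f (z + t • v) - f z) / t, ?_,
      fun z hz => hε𝒱 ?_⟩
    · have h1 : ContinuousAt (fun z => f (z + t • v)) a :=
        ContinuousAt.comp' (hf.continuousAt (hU.mem_nhds htU)) (by fun_prop)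
      exact (h1.sub (hf.continuousAt (hU.mem_nhds ha))).div_const t
    · rw [dist_comm, dist_eq_norm]
      exact (ht z hz).trans_lt htε
  have hadd (u v : E) : lineDeriv ℂ f a (u + v) = lineDeriv ℂ f a u + lineDeriv ℂ f a v := by
    have hslope (z w : E) (hz : z ∈ U) :
        Tendsto (fun t : ℂ => (f (z + t • w) - f z) / t) (𝓝[≠] 0) (𝓝 (lineDeriv ℂ f z w)) := by
      have hd : LineDifferentiableAt ℂ f z w := (hline z w).differentiableAt <| by
        have : Continuous fun t : ℂ => z + t • w := by fun_prop
        exact (hU.preimage this).mem_nhds (by simpa using hz)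
      refine hd.hasLineDerivAt.tendsto_slope_zero.congr fun t => ?_
      rw [smul_eq_mul, div_eq_inv_mul]
    have hshift : Tendsto (fun t : ℂ => a + t • u) (𝓝[≠] 0) (𝓝 a) :=
      (Continuous.tendsto' (by fun_prop) 0 a (by simp)).mono_left nhdsWithin_le_nhds
    have hmoving : Tendsto (fun t : ℂ => (f (a + t • u + t • v) - f (a + t • u)) / t) (𝓝[≠] 0)
        (𝓝 (lineDeriv ℂ f a v)) := by
      have h1 : Tendsto (fun t : ℂ => (f (a + t • u + t • v) - f (a + t • u)) / t
          - lineDeriv ℂ f (a + t • u) v) (𝓝[≠] 0) (𝓝 0) := by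
        refine squeeze_zero_norm' (a := fun t : ℂ => C * ‖v‖ ^ 2 * ‖t‖) ?_ ?_
        · filter_upwards [hquot v, hshift.eventually_mem (ball_mem_nhds a hr)] with t h1 h2
          exact h1 _ h2
        · exact (Continuous.tendsto' (by fun_prop) 0 0 (by simp)).mono_left nhdsWithin_le_nhds
      simpa using h1.add ((hcont v).tendsto.comp hshift)
    refine tendsto_nhds_unique (hslope a (u + v) ha)
      (((hslope a u ha).add hmoving).congr fun t => ?_)
    rw [smul_add, add_assoc]
    ring
  let L : E →ₗ[ℂ] ℂ :=
    { toFun := lineDeriv ℂ f a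
      map_add' := hadd
      map_smul' := fun c v => lineDeriv_smul }
  have hL : HasFDerivAt f L.toContinuousLinearMap a := by
    rw [hasFDerivAt_iff_isLittleO_nhds_zero]
    have hO : (fun v => f (a + v) - f a - L.toContinuousLinearMap v) =O[𝓝 0]
        fun v : E => ‖v‖ ^ 2 := by
      refine Asymptotics.IsBigO.of_bound C ?_
      filter_upwards [ball_mem_nhds (0 : E) hr] with v hv
      simpa [L] using hC a ha0 v (mem_ball_zero_iff.1 hv)
    have hpow := Asymptotics.isLittleO_norm_pow_id (E' := E) one_lt_two
    exact hO.trans_isLittleO hpow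
  exact hL.differentiableAt

/-- **Radó's theorem** for scalar functions of several variables. -/
theorem differentiableOn_of_differentiableOn_off_zeros_of_finiteDimensional {E : Type*}
    [NormedAddCommGroup E] [NormedSpace ℂ E] [FiniteDimensional ℂ E] {U : Set E} (hU : IsOpen U)
    {f : E → ℂ} (hf : ContinuousOn f U) (hfd : DifferentiableOn ℂ f (U \ {z | f z = 0})) :
    DifferentiableOn ℂ f U := by
  refine differentiableOn_of_continuousOn_of_differentiableOn_lines hU hf fun z v => ?_
  have hline : Differentiable ℂ fun t : ℂ => z + t • v := by fun_prop
  exact differentiableOn_of_differentiableOn_off_zeros (hU.preimage hline.continuous)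
    (hf.comp hline.continuous.continuousOn fun _ ht => ht)
    (hfd.comp hline.differentiableOn fun _ ht => ht)

/-- Rado's theorem in several variables: a continuous function on an open set
`D ⊆ ℂⁿ` that is holomorphic off its zero set is holomorphic on all of `D`. -/
theorem stmt_6 (n m : ℕ) (D : Set (Fin n → ℂ)) (hD : IsOpen D)
    (f : (Fin n → ℂ) → (Fin m → ℂ))
    (hf : ContinuousOn f D)
    (hol : DifferentiableOn ℂ f (D \ {z | f z = 0})) :
    DifferentiableOn ℂ f D := by
  rw [differentiableOn_pi] at hol ⊢
  intro i
  refine differentiableOn_of_differentiableOn_off_zeros_of_finiteDimensional hD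
    (continuousOn_pi.1 hf i) ((hol i).mono fun z hz => ⟨hz.1, fun h => hz.2 ?_⟩)
  exact congrFun h i
end

section
/- Let D ⊆ ℂⁿ be a domain (nonempty connected open set) and let f : D → ℂᵐ be a map of class C¹ (continuously real-differentiable on D). Suppose that for every p ∈ D the real Fréchet derivative f'(p) : ℂⁿ → ℂᵐ is either ℂ-linear (f'(p)(i·v) = i·f'(p)(v) for all v ∈ ℂⁿ) or ℂ-antilinear (f'(p)(i·v) = −i·f'(p)(v) for all v ∈ ℂⁿ), i.e. f_z(p) = 0 or f_{z̄}(p) = 0 at each point. Then f is holomorphic on D or f is antiholomorphic on D (i.e. the coordinatewise complex conjugate z ↦ conj∘f(z) is holomorphic on D). -/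
open Complex Metric Set Topology

/-- A real function continuous on a circle about the origin is uniformly approximated there by
real parts of entire functions. -/
lemma exists_entire_re_approx_on_sphere {R : ℝ} (hR : 0 < R) {φ : ℂ → ℝ}
    (hφ : ContinuousOn φ (sphere 0 R)) {ε : ℝ} (hε : 0 < ε) :
    ∃ p : ℂ → ℂ, Differentiable ℂ p ∧ ∀ z ∈ sphere (0 : ℂ) R, |φ z - (p z).re| ≤ ε := by
  have hT : (2 * Real.pi) ≠ 0 := by positivity
  have : Fact (0 < 2 * Real.pi) := ⟨by positivity⟩
  have hmem : ∀ t : AddCircle (2 * Real.pi), (R : ℂ) * (t.toCircle : ℂ) ∈ sphere (0 : ℂ) R := by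
    intro t
    rw [mem_sphere_zero_iff_norm, norm_mul, Circle.norm_coe]
    simp [abs_of_pos hR]
  let ψ : C(AddCircle (2 * Real.pi), ℂ) :=
    ⟨fun t => (φ ((R : ℂ) * (t.toCircle : ℂ)) : ℂ), by
      refine continuous_ofReal.comp (hφ.comp_continuous ?_ hmem)
      have := AddCircle.continuous_toCircle (T := 2 * Real.pi)
      fun_prop⟩
  have hψ : ψ ∈ closure (Submodule.span ℂ (range <| @fourier (2 * Real.pi)) :
      Set C(AddCircle (2 * Real.pi), ℂ)) := by
    rw [← Submodule.topologicalClosure_coe, span_fourier_closure_eq_top]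
    trivial
  obtain ⟨x, hx, hxε⟩ := Metric.mem_closure_iff.1 hψ ε hε
  have hrep : ∃ P Q : ℂ → ℂ, Differentiable ℂ P ∧ Differentiable ℂ Q ∧
      ∀ t : AddCircle (2 * Real.pi),
        x t = P (t.toCircle : ℂ) + starRingEnd ℂ (Q (t.toCircle : ℂ)) := by
    clear hxε
    induction hx using Submodule.span_induction with
    | mem y hy =>
      obtain ⟨k, rfl⟩ := hy
      obtain ⟨j, rfl | rfl⟩ := k.eq_nat_or_neg
      · refine ⟨fun z => z ^ j, fun _ => 0, by fun_prop, by fun_prop, fun t => ?_⟩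
        simp [fourier_apply, AddCircle.toCircle_nsmul]
      · refine ⟨fun _ => 0, fun z => z ^ j, by fun_prop, by fun_prop, fun t => ?_⟩
        rw [fourier_neg]
        simp [fourier_apply, AddCircle.toCircle_nsmul]
    | zero => exact ⟨fun _ => 0, fun _ => 0, by fun_prop, by fun_prop, fun t => by simp⟩
    | add y w _ _ hy hw =>
      obtain ⟨P, Q, hP, hQ, h⟩ := hy
      obtain ⟨P', Q', hP', hQ', h'⟩ := hw
      refine ⟨fun z => P z + P' z, fun z => Q z + Q' z, by fun_prop, by fun_prop, fun t => ?_⟩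
      simp only [ContinuousMap.add_apply, h, h', map_add]
      ring
    | smul a y _ hy =>
      obtain ⟨P, Q, hP, hQ, h⟩ := hy
      refine ⟨fun z => a * P z, fun z => starRingEnd ℂ a * Q z, by fun_prop, by fun_prop,
        fun t => ?_⟩
      simp only [ContinuousMap.smul_apply, h, map_mul, smul_eq_mul, conj_conj]
      ring
  obtain ⟨P, Q, hP, hQ, h⟩ := hrep
  refine ⟨fun z => P (z / R) + Q (z / R), by fun_prop, fun z hz => ?_⟩
  have hRc : (R : ℂ) ≠ 0 := by exact_mod_cast hR.ne'
  have hzc : z / R ∈ Submonoid.unitSphere ℂ := by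
    rw [mem_sphere_zero_iff_norm] at hz
    simp [Submonoid.unitSphere, hz, abs_of_pos hR, hR.ne']
  obtain ⟨t, ht⟩ := (AddCircle.homeomorphCircle hT).surjective ⟨z / R, hzc⟩
  rw [AddCircle.homeomorphCircle_apply] at ht
  have ht' : (t.toCircle : ℂ) = z / R := by rw [ht]
  have h1 : ‖ψ t - x t‖ ≤ ε := by
    rw [← dist_eq_norm]
    exact (ContinuousMap.dist_apply_le_dist t).trans hxε.le
  have h2 : ψ t = φ z := by
    change ((φ ((R : ℂ) * (t.toCircle : ℂ)) : ℝ) : ℂ) = φ z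
    rw [ht', mul_div_cancel₀ _ hRc]
  have h3 := (abs_re_le_norm _).trans h1
  rw [h2, h t, ht'] at h3
  simpa using h3

/-- If a continuous function `u` on a closed disc satisfies the maximum principle against real parts
of all entire functions, then it is the real part of a holomorphic function on the open disc. -/
lemma exists_differentiableOn_re_eq_of_abs_sub_le {R : ℝ} (hR : 0 < R) {u : ℂ → ℝ}
    (hu : ContinuousOn u (closedBall 0 R))
    (hmax : ∀ p : ℂ → ℂ, Differentiable ℂ p → ∀ M : ℝ,
      (∀ z ∈ sphere (0 : ℂ) R, |u z - (p z).re| ≤ M) → ∀ z ∈ ball (0 : ℂ) R,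
        |u z - (p z).re| ≤ M) :
    ∃ P : ℂ → ℂ, DifferentiableOn ℂ P (ball 0 R) ∧ ∀ z ∈ ball (0 : ℂ) R, u z = (P z).re := by
  have hus : ContinuousOn u (sphere 0 R) := hu.mono sphere_subset_closedBall
  have hci : CircleIntegrable u 0 R := hus.circleIntegrable hR.le
  have hci' : CircleIntegrable (fun z => (u z : ℂ)) 0 R :=
    (continuous_ofReal.comp_continuousOn hus).circleIntegrable hR.le
  refine ⟨_, differentiableOn_circleAverage_herglotzRieszKernel_smul hci', fun w hw => ?_⟩
  rw [re_circleAverage_herglotzRieszKernel_smul hci hw]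
  set K : ℂ → ℝ := Complex.re ∘ herglotzRieszKernel 0 w with hK
  have hKc : ContinuousOn K (sphere 0 R) := by
    have := continuousOn_herglotzRieszKernel_sphere hw
    rw [abs_of_pos hR] at this
    exact continuous_re.comp_continuousOn this
  obtain ⟨C, hC⟩ := (isCompact_sphere (0 : ℂ) R).exists_bound_of_continuousOn hKc
  have hC0 : 0 ≤ C := (norm_nonneg _).trans (hC (R : ℂ) (by simp [abs_of_pos hR]))
  refine eq_of_forall_dist_le fun δ hδ => ?_
  obtain ⟨p, hp, hpε⟩ := exists_entire_re_approx_on_sphere hR hus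
    (ε := δ / (C + 1)) (by positivity)
  have h1 := hmax p hp _ hpε w hw
  have hpr : ContinuousOn (fun z => (p z).re) (sphere 0 R) :=
    (continuous_re.comp hp.continuous).continuousOn
  have h2 : Real.circleAverage (K • fun z => (p z).re) 0 R = (p w).re := by
    have h := hp.diffContOnCl.circleAverage_re_herglotzRieszKernel_smul (c := 0) (R := R) hw
    have h' := reCLM.circleAverage_comp_comm (f := K • p) (c := 0) (R := R)
      ((hKc.smul hp.continuous.continuousOn).circleIntegrable hR.le)
    rw [h] at h'
    rw [← reCLM_apply, ← h']
    congr 1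
    ext z
    simp
  have h3 : Real.circleAverage (K • u) 0 R - (p w).re
      = Real.circleAverage (K • u - K • fun z => (p z).re) 0 R := by
    rw [Real.circleAverage_sub ((hKc.smul hus).circleIntegrable hR.le)
      ((hKc.smul hpr).circleIntegrable hR.le), h2]
  have hcont : ContinuousOn (K • u - K • fun z => (p z).re) (sphere 0 R) :=
    (hKc.smul hus).sub (hKc.smul hpr)
  have h4 : |Real.circleAverage (K • u) 0 R - (p w).re| ≤ C * (δ / (C + 1)) := by
    rw [h3]
    refine Real.abs_circleAverage_le_circleAverage_abs.trans ?_
    refine Real.circleAverage_mono_on_of_le_circle (hcont.abs.circleIntegrable hR.le) ?_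
    intro z hz
    rw [abs_of_pos hR] at hz
    have : (K • u - K • fun z => (p z).re) z = K z * (u z - (p z).re) := by
      simp [mul_sub]
    rw [Pi.abs_apply, this, abs_mul]
    exact mul_le_mul (hC z hz) (hpε z hz) (abs_nonneg _) hC0
  rw [Real.dist_eq]
  calc |u w - Real.circleAverage (K • u) 0 R|
      = |(u w - (p w).re) - (Real.circleAverage (K • u) 0 R - (p w).re)| := by ring_nf
    _ ≤ δ / (C + 1) + C * (δ / (C + 1)) := (abs_sub _ _).trans (add_le_add h1 h4)
    _ = δ := by field_simp; ring

section ComplexLinearity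

variable {E F : Type*} [NormedAddCommGroup E] [NormedSpace ℂ E]
  [NormedAddCommGroup F] [NormedSpace ℂ F]

/-- A real-linear map between complex spaces commutes with multiplication by `I`. -/
def IsComplexLinear (T : E →L[ℝ] F) : Prop := ∀ v, T (I • v) = I • T v

/-- A real-linear map between complex spaces anticommutes with multiplication by `I`. -/
def IsComplexAntilinear (T : E →L[ℝ] F) : Prop := ∀ v, T (I • v) = -(I • T v)

lemma IsComplexLinear.eq_zero_of_isComplexAntilinear {T : E →L[ℝ] F} (h : IsComplexLinear T)
    (h' : IsComplexAntilinear T) (v : E) : T v = 0 := by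
  have h1 : I • T v = -(I • T v) := (h v).symm.trans (h' v)
  rw [eq_neg_iff_add_eq_zero, ← two_smul ℂ] at h1
  simpa using h1

lemma isClosed_setOf_isComplexLinear : IsClosed {T : E →L[ℝ] F | IsComplexLinear T} := by
  simp only [IsComplexLinear, ofPred_forall]
  refine isClosed_iInter fun v => isClosed_eq ?_ ?_ <;> fun_prop

lemma isClosed_setOf_isComplexAntilinear : IsClosed {T : E →L[ℝ] F | IsComplexAntilinear T} := by
  simp only [IsComplexAntilinear, ofPred_forall]
  refine isClosed_iInter fun v => isClosed_eq ?_ ?_ <;> fun_prop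

lemma IsComplexLinear.differentiableAt {f : E → F} {x : E} (hf : DifferentiableAt ℝ f x)
    (h : IsComplexLinear (fderiv ℝ f x)) : DifferentiableAt ℂ f x := by
  let T : E →L[ℂ] F :=
    { toFun := fderiv ℝ f x
      map_add' := map_add _
      map_smul' := fun c v => by
        conv_lhs => rw [← re_add_im c, add_smul, mul_smul, map_add]
        simp only [coe_smul, map_smul, RingHom.id_apply]
        rw [h v]
        conv_rhs => rw [← re_add_im c, add_smul, mul_smul]
        simp only [coe_smul]
      cont := (fderiv ℝ f x).continuous }
  exact (hasFDerivAt_of_restrictScalars ℝ (f' := T) hf.hasFDerivAt rfl).differentiableAt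

end ComplexLinearity

/-- A form of the maximum principle for the real part of a function which is holomorphic off the
zero set of `g`. -/
lemma re_le_of_forall_mem_frontier_re_le {S U : Set ℂ} {F g : ℂ → ℂ} (hS : Bornology.IsBounded S)
    (hSo : IsOpen S) (hUo : IsOpen U)
    (hUS : U ⊆ S) (hFc : ContinuousOn F (closure S)) (hgc : ContinuousOn g (closure S))
    (hF : DifferentiableOn ℂ F U) (hg : DifferentiableOn ℂ g U) (hg0 : ∀ z ∈ S, z ∉ U → g z = 0)
    {M : ℝ} (hM : ∀ z ∈ frontier S, (F z).re ≤ M) {z : ℂ} (hz : z ∈ U) (hgz : g z ≠ 0) :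
    (F z).re ≤ M := by
  have hcl : closure U ⊆ closure S := closure_mono hUS
  obtain ⟨C, hC⟩ := hS.isCompact_closure.exists_bound_of_continuousOn hgc
  have key : ∀ N : ℕ, ‖exp (N * F z) * g z‖ ≤ Real.exp (N * M) * C := by
    intro N
    refine norm_le_of_forall_mem_frontier_norm_le (hS.subset hUS)
      (f := fun z => exp (N * F z) * g z) ⟨by fun_prop, ?_⟩ ?_ (subset_closure hz)
    · have := hFc.mono hcl
      have := hgc.mono hcl
      fun_prop
    · intro w hw
      rw [hUo.frontier_eq] at hw
      have hwS := hcl hw.1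
      have hC0 : 0 ≤ C := (norm_nonneg _).trans (hC w hwS)
      by_cases hwS' : w ∈ S
      · rw [hg0 w hwS' hw.2, mul_zero, norm_zero]
        positivity
      · rw [norm_mul, norm_exp]
        have h1 : (F w).re ≤ M := hM w (by rw [hSo.frontier_eq]; exact ⟨hwS, hwS'⟩)
        have h2 : ((N : ℂ) * F w).re = N * (F w).re := by simp
        rw [h2]
        gcongr
        exact hC w hwS
  by_contra! hlt
  have hgp : 0 < ‖g z‖ := norm_pos_iff.2 hgz
  have hbd : ∀ N : ℕ, (N : ℝ) * ((F z).re - M) ≤ C / ‖g z‖ := by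
    intro N
    have h := key N
    rw [norm_mul, norm_exp] at h
    have h2 : ((N : ℂ) * F z).re = N * (F z).re := by simp
    rw [h2] at h
    have h3 : Real.exp (N * ((F z).re - M)) ≤ C / ‖g z‖ := by
      rw [mul_sub, Real.exp_sub, div_le_div_iff₀ (Real.exp_pos _) hgp]
      linarith
    linarith [Real.add_one_le_exp ((N : ℝ) * ((F z).re - M))]
  obtain ⟨N, hN⟩ := exists_nat_gt (C / ‖g z‖ / ((F z).re - M))
  have := hbd N
  rw [div_lt_iff₀ (by linarith)] at hN
  linarith

lemma fderiv_conj_comp {E : Type*} [NormedAddCommGroup E] [NormedSpace ℂ E] {f : E → ℂ} {z : E} :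
    fderiv ℝ (fun z => starRingEnd ℂ (f z)) z = (conjCLE : ℂ →L[ℝ] ℂ).comp (fderiv ℝ f z) :=
  conjCLE.comp_fderiv (f := f) (x := z)

/-- Maximum principle for `Re (f - p)` at points where the derivative of `f` is not antilinear. -/
lemma re_sub_le_of_not_isComplexAntilinear {R : ℝ} (hR : 0 < R) {D : Set ℂ} (hDo : IsOpen D)
    (hD : closedBall 0 R ⊆ D) {f : ℂ → ℂ} (hf : ContDiffOn ℝ 1 f D)
    (h : ∀ z ∈ D, IsComplexLinear (fderiv ℝ f z) ∨ IsComplexAntilinear (fderiv ℝ f z))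
    {p : ℂ → ℂ} (hp : Differentiable ℂ p) {M : ℝ}
    (hM : ∀ z ∈ sphere (0 : ℂ) R, (f z - p z).re ≤ M) {z : ℂ} (hz : z ∈ ball 0 R)
    (hza : ¬ IsComplexAntilinear (fderiv ℝ f z)) : (f z - p z).re ≤ M := by
  have hfd : ContinuousOn (fderiv ℝ f) D := hf.continuousOn_fderiv_of_isOpen hDo le_rfl
  have hbD : ball (0 : ℂ) R ⊆ D := ball_subset_closedBall.trans hD
  set g : ℂ → ℂ := fun z => fderiv ℝ f z 1 - I * fderiv ℝ f z I with hg
  have hgc : ContinuousOn g D := by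
    refine (hfd.clm_apply continuousOn_const).sub
      (continuousOn_const.mul (hfd.clm_apply continuousOn_const))
  have hanti : ∀ w, IsComplexAntilinear (fderiv ℝ f w) → g w = 0 := by
    intro w hw
    have h1 := hw 1
    simp only [smul_eq_mul, mul_one] at h1
    simp only [hg, h1]
    linear_combination (fderiv ℝ f w 1) * I_mul_I
  have hlin : ∀ w, IsComplexLinear (fderiv ℝ f w) → g w = 2 * fderiv ℝ f w 1 := by
    intro w hw
    have h1 := hw 1
    simp only [smul_eq_mul, mul_one] at h1
    simp only [hg, h1]
    linear_combination -(fderiv ℝ f w 1) * I_mul_I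
  have hdR : ∀ w ∈ D, DifferentiableAt ℝ f w := fun w hw =>
    (hf.differentiableOn one_ne_zero).differentiableAt (hDo.mem_nhds hw)
  set U : Set ℂ := ball 0 R ∩ g ⁻¹' {0}ᶜ with hU
  have hUo : IsOpen U := (hgc.mono hbD).isOpen_inter_preimage isOpen_ball isOpen_compl_singleton
  have hUlin : ∀ w ∈ U, IsComplexLinear (fderiv ℝ f w) := fun w hw =>
    (h w (hbD hw.1)).resolve_right fun ha => hw.2 (hanti w ha)
  have hfU : DifferentiableOn ℂ f U := fun w hw =>
    ((hUlin w hw).differentiableAt (hdR w (hbD hw.1))).differentiableWithinAt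
  have hgU : DifferentiableOn ℂ g U := by
    refine ((hfU.deriv hUo).const_mul 2).congr fun w hw => ?_
    rw [hlin w (hUlin w hw)]
    have hd : DifferentiableAt ℂ f w := hfU.differentiableAt (hUo.mem_nhds hw)
    rw [hd.fderiv_restrictScalars ℝ]
    simp
  have hgz : g z ≠ 0 := by
    intro h0
    refine hza ?_
    have hl := (h z (hbD hz)).resolve_right hza
    rw [hlin z hl] at h0
    have h1 : fderiv ℝ f z 1 = 0 := by simpa using h0
    have hd := hl.differentiableAt (hdR z (hbD hz))
    have h2 : fderiv ℝ f z = 0 := by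
      rw [hd.fderiv_restrictScalars ℝ] at h1 ⊢
      have : fderiv ℂ f z = 0 := by ext; simpa using h1
      rw [this]; rfl
    rw [h2]
    intro v
    simp
  have hclos : closure (ball (0 : ℂ) R) = closedBall 0 R := closure_ball _ hR.ne'
  refine re_le_of_forall_mem_frontier_re_le (S := ball 0 R) (U := U)
    (F := fun z => f z - p z) (g := g) isBounded_ball isOpen_ball hUo inter_subset_left ?_ ?_ ?_ hgU
    ?_ ?_ ⟨hz, hgz⟩ hgz
  · rw [hclos]
    exact (hf.continuousOn.mono hD).sub hp.continuous.continuousOn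
  · rw [hclos]
    exact hgc.mono hD
  · exact hfU.sub hp.differentiableOn
  · intro w hw hwU
    by_contra h0
    exact hwU ⟨hw, h0⟩
  · rw [frontier_ball _ hR.ne']
    exact hM

lemma IsComplexLinear.conj_comp_iff {E : Type*} [NormedAddCommGroup E] [NormedSpace ℂ E]
    {T : E →L[ℝ] ℂ} :
    IsComplexLinear ((conjCLE : ℂ →L[ℝ] ℂ).comp T) ↔ IsComplexAntilinear T := by
  refine forall_congr' fun v => ?_
  rw [← (starRingEnd ℂ).injective.eq_iff]
  simp

lemma IsComplexAntilinear.conj_comp_iff {E : Type*} [NormedAddCommGroup E] [NormedSpace ℂ E]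
    {T : E →L[ℝ] ℂ} :
    IsComplexAntilinear ((conjCLE : ℂ →L[ℝ] ℂ).comp T) ↔ IsComplexLinear T := by
  refine forall_congr' fun v => ?_
  rw [← (starRingEnd ℂ).injective.eq_iff]
  simp

/-- Maximum principle for `Re (f - p)`, where `f` is a `C¹` function whose derivative is linear or
antilinear at each point and `p` is entire. -/
lemma re_sub_le_of_forall_mem_sphere {R : ℝ} (hR : 0 < R) {D : Set ℂ} (hDo : IsOpen D)
    (hD : closedBall 0 R ⊆ D) {f : ℂ → ℂ} (hf : ContDiffOn ℝ 1 f D)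
    (h : ∀ z ∈ D, IsComplexLinear (fderiv ℝ f z) ∨ IsComplexAntilinear (fderiv ℝ f z))
    {p : ℂ → ℂ} (hp : Differentiable ℂ p) {M : ℝ}
    (hM : ∀ z ∈ sphere (0 : ℂ) R, (f z - p z).re ≤ M) {z : ℂ} (hz : z ∈ ball 0 R) :
    (f z - p z).re ≤ M := by
  by_contra! hlt
  have hbD : ball (0 : ℂ) R ⊆ D := ball_subset_closedBall.trans hD
  have hcc : ContinuousOn (fun z => (f z - p z).re) (closedBall 0 R) :=
    continuous_re.comp_continuousOn ((hf.continuousOn.mono hD).sub hp.continuous.continuousOn)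
  set O : Set ℂ := ball 0 R ∩ (fun z => (f z - p z).re) ⁻¹' Ioi M with hO
  have hOo : IsOpen O :=
    (hcc.mono ball_subset_closedBall).isOpen_inter_preimage isOpen_ball isOpen_Ioi
  have hOsub : O ⊆ ball 0 R := inter_subset_left
  have hclO : closure O ⊆ closedBall 0 R :=
    (closure_mono hOsub).trans closure_ball_subset_closedBall
  have hlin : ∀ w ∈ O, IsComplexLinear (fderiv ℝ f w) := by
    intro w hw
    by_contra hnl
    have hre : ∀ z, (starRingEnd ℂ (f z) - p z).re = (f z - p z).re := by simp
    have := re_sub_le_of_not_isComplexAntilinear hR hDo hD (f := fun z => starRingEnd ℂ (f z))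
      (conjCLE.contDiff.comp_contDiffOn hf) (fun z hz => by
        rw [fderiv_conj_comp, IsComplexLinear.conj_comp_iff, IsComplexAntilinear.conj_comp_iff]
        exact (h z hz).symm) hp (M := M) (fun z hz => (hre z).trans_le (hM z hz)) hw.1 (by
        rwa [fderiv_conj_comp, IsComplexAntilinear.conj_comp_iff])
    rw [hre] at this
    exact not_lt.2 this hw.2
  have hfO : DifferentiableOn ℂ f O := fun w hw => ((hlin w hw).differentiableAt
    ((hf.differentiableOn one_ne_zero).differentiableAt
      (hDo.mem_nhds (hbD hw.1)))).differentiableWithinAt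
  have hle := norm_le_of_forall_mem_frontier_norm_le (isBounded_ball.subset hOsub)
    (f := fun z => exp (f z - p z)) (C := Real.exp M) ⟨by fun_prop, ?_⟩ ?_
    (subset_closure (⟨hz, hlt⟩ : z ∈ O))
  · rw [norm_exp, Real.exp_le_exp] at hle
    exact absurd hle (not_le.2 hlt)
  · exact continuous_exp.comp_continuousOn
      ((hf.continuousOn.mono (hclO.trans hD)).sub hp.continuous.continuousOn)
  · intro w hw
    rw [hOo.frontier_eq] at hw
    rw [norm_exp, Real.exp_le_exp]
    by_cases hwb : w ∈ ball 0 R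
    · by_contra! hlt'
      exact hw.2 ⟨hwb, hlt'⟩
    · refine hM w ?_
      have h1 := hclO hw.1
      rw [mem_closedBall] at h1
      rw [mem_ball, not_lt] at hwb
      exact le_antisymm h1 hwb

/-- A `C¹` function near a closed disc whose derivative is linear or antilinear at each point is the
sum of a holomorphic and an antiholomorphic function on the open disc. -/
lemma exists_eq_add_conj {R : ℝ} (hR : 0 < R) {D : Set ℂ} (hDo : IsOpen D)
    (hD : closedBall 0 R ⊆ D) {f : ℂ → ℂ} (hf : ContDiffOn ℝ 1 f D)
    (h : ∀ z ∈ D, IsComplexLinear (fderiv ℝ f z) ∨ IsComplexAntilinear (fderiv ℝ f z)) :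
    ∃ A B : ℂ → ℂ, DifferentiableOn ℂ A (ball 0 R) ∧ DifferentiableOn ℂ B (ball 0 R) ∧
      ∀ z ∈ ball (0 : ℂ) R, f z = A z + starRingEnd ℂ (B z) := by
  have hre : ∀ c : ℂ, ∃ P : ℂ → ℂ, DifferentiableOn ℂ P (ball 0 R) ∧
      ∀ z ∈ ball (0 : ℂ) R, (c * f z).re = (P z).re := by
    intro c
    refine exists_differentiableOn_re_eq_of_abs_sub_le hR (continuous_re.comp_continuousOn
      (continuousOn_const.mul (hf.continuousOn.mono hD))) fun p hp M hM z hz => ?_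
    have hcond : ∀ b : ℂ, ∀ z ∈ D, IsComplexLinear (fderiv ℝ (fun z => b * f z) z) ∨
        IsComplexAntilinear (fderiv ℝ (fun z => b * f z) z) := by
      intro b z hz
      have hd := (hf.differentiableOn one_ne_zero).differentiableAt (hDo.mem_nhds hz)
      rw [fderiv_const_mul hd]
      refine (h z hz).imp (fun H v => ?_) (fun H v => ?_)
      · rw [smul_apply, smul_apply, H v]
        simp only [smul_eq_mul]
        ring
      · rw [smul_apply, smul_apply, H v]
        simp only [smul_eq_mul]
        ring
    have h1 := re_sub_le_of_forall_mem_sphere hR hDo hD (contDiffOn_const.mul hf) (hcond c) hp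
      (M := M) (fun w hw => (le_abs_self _).trans (by simpa using hM w hw)) hz
    have h2 := re_sub_le_of_forall_mem_sphere hR hDo hD (contDiffOn_const.mul hf) (hcond (-c))
      hp.neg (M := M) (fun w hw => (neg_le_abs ((c * f w).re - (p w).re)).trans' (by simp; linarith)
        |>.trans (hM w hw)) hz
    rw [abs_le]
    simp only [neg_mul, Pi.neg_apply, sub_re, neg_re] at h1 h2
    constructor <;> linarith
  obtain ⟨P, hP, hPf⟩ := hre 1
  obtain ⟨Q, hQ, hQf⟩ := hre (-I)
  refine ⟨fun z => ((2⁻¹ : ℝ) : ℂ) * (P z + I * Q z),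
    fun z => ((2⁻¹ : ℝ) : ℂ) * (P z - I * Q z), by fun_prop,
    by fun_prop, fun z hz => ?_⟩
  have h1 := hPf z hz
  have h2 := hQf z hz
  simp only [one_mul] at h1
  simp only [neg_mul, neg_re, mul_re, I_re, I_im, zero_mul, one_mul, zero_sub, neg_neg] at h2
  apply Complex.ext
  · rw [add_re, conj_re, re_ofReal_mul, re_ofReal_mul]
    simp [h1]
    ring
  · rw [add_im, conj_im, im_ofReal_mul, im_ofReal_mul]
    simp [h2]
    ring

/-- One of the alternatives `L`, `A` holds on all of `N`, and `L` and `A` hold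
simultaneously on `N` as soon as they do so on some nonempty open subset of `N`. -/
def RigidDichotomy {X : Type*} [TopologicalSpace X] (L A N : Set X) : Prop :=
  (N ⊆ L ∨ N ⊆ A) ∧ ∀ W : Set X, IsOpen W → W.Nonempty → W ⊆ N → W ⊆ L ∩ A → N ⊆ L ∩ A

lemma RigidDichotomy.of_local {X : Type*} [TopologicalSpace X] {L A D : Set X}
    (hc : IsPreconnected D)
    (h : ∀ p ∈ D, ∃ N, IsOpen N ∧ p ∈ N ∧ RigidDichotomy L A N) : RigidDichotomy L A D := by
  have hspread : (D ∩ interior (L ∩ A)).Nonempty → D ⊆ interior (L ∩ A) := by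
    intro hne
    refine hc.subset_of_closure_inter_subset isOpen_interior hne ?_
    rintro p ⟨hp, hpD⟩
    obtain ⟨N, hNo, hpN, -, hN⟩ := h p hpD
    have hsub := hN (N ∩ interior (L ∩ A)) (hNo.inter isOpen_interior)
      (mem_closure_iff.1 hp N hNo hpN) inter_subset_left (inter_subset_right.trans interior_subset)
    exact interior_maximal hsub hNo hpN
  constructor
  · by_cases hL : (D ∩ interior L).Nonempty
    · by_cases hA : (D ∩ interior A).Nonempty
      · left
        have hcov : D ⊆ interior L ∪ interior A := by
          intro p hp
          obtain ⟨N, hNo, hpN, hN, -⟩ := h p hp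
          exact hN.imp (fun H => interior_maximal H hNo hpN) (fun H => interior_maximal H hNo hpN)
        have hne := hc _ _ isOpen_interior isOpen_interior hcov hL hA
        rw [← interior_inter] at hne
        exact (hspread hne).trans (interior_subset.trans inter_subset_left)
      · left
        intro p hp
        obtain ⟨N, hNo, hpN, hN, -⟩ := h p hp
        rcases hN with H | H
        · exact H hpN
        · exact absurd ⟨p, hp, interior_maximal H hNo hpN⟩ hA
    · right
      intro p hp
      obtain ⟨N, hNo, hpN, hN, -⟩ := h p hp
      rcases hN with H | H
      · exact absurd ⟨p, hp, interior_maximal H hNo hpN⟩ hL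
      · exact H hpN
  · rintro W hWo ⟨w, hw⟩ hWD hWLA
    exact (hspread ⟨w, hWD hw, interior_maximal hWLA hWo hw⟩).trans interior_subset

/-- The dichotomy on a disc of the complex plane. -/
lemma rigidDichotomy_ball {m : ℕ} {c : ℂ} {R : ℝ} (hR : 0 < R) {D : Set ℂ} (hDo : IsOpen D)
    (hD : closedBall c R ⊆ D) {f : ℂ → Fin m → ℂ} (hf : ContDiffOn ℝ 1 f D)
    (h : ∀ z ∈ D, IsComplexLinear (fderiv ℝ f z) ∨ IsComplexAntilinear (fderiv ℝ f z)) :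
    RigidDichotomy {z | IsComplexLinear (fderiv ℝ f z)} {z | IsComplexAntilinear (fderiv ℝ f z)}
      (ball c R) := by
  have hbD : ball c R ⊆ D := ball_subset_closedBall.trans hD
  have hdR : ∀ w ∈ D, DifferentiableAt ℝ f w := fun w hw =>
    (hf.differentiableOn one_ne_zero).differentiableAt (hDo.mem_nhds hw)
  have hsplit : ∀ j, ∃ A B : ℂ → ℂ, DifferentiableOn ℂ A (ball c R) ∧
      DifferentiableOn ℂ B (ball c R) ∧
      ∀ z ∈ ball c R, f z j = A z + starRingEnd ℂ (B z) := by
    intro j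
    have hmaps : MapsTo (fun z => z - c) (ball c R) (ball 0 R) := fun z hz => by
      simpa [dist_eq_norm] using hz
    obtain ⟨A, B, hA, hB, hAB⟩ := exists_eq_add_conj hR
      (D := (fun z => z + c) ⁻¹' D) (f := fun z => f (z + c) j) (hDo.preimage (by fun_prop))
      (fun z hz => hD (by simpa [dist_eq_norm] using hz))
      ((contDiffOn_pi.1 hf j).comp (contDiff_id.add contDiff_const).contDiffOn fun z hz => hz)
      (fun z hz => by
        rw [fderiv_comp_add_right (f := fun z => f z j) c, fderiv_apply (hdR _ hz)]
        exact (h _ hz).imp (fun H v => congrFun (H v) j) (fun H v => congrFun (H v) j))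
    refine ⟨fun z => A (z - c), fun z => B (z - c), hA.comp (by fun_prop) hmaps,
      hB.comp (by fun_prop) hmaps, fun z hz => ?_⟩
    rw [← hAB _ (hmaps hz), sub_add_cancel]
  choose A B hA hB hAB using hsplit
  have hder : ∀ z ∈ ball c R, ∀ v j, fderiv ℝ f z v j =
      deriv (A j) z * v + starRingEnd ℂ (deriv (B j) z * v) := by
    intro z hz v j
    have hnhds := isOpen_ball.mem_nhds hz
    have h1 := ((hA j).differentiableAt hnhds).hasDerivAt.hasFDerivAt.restrictScalars ℝ
    have h2 := ((hB j).differentiableAt hnhds).hasDerivAt.hasFDerivAt.restrictScalars ℝ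
    have h3 := h1.add ((conjCLE : ℂ →L[ℝ] ℂ).hasFDerivAt.comp z h2)
    have h4 : HasFDerivAt (fun z => f z j) _ z := h3.congr_of_eventuallyEq <| by
      filter_upwards [hnhds] with w hw
      simp [hAB j w hw]
    have h5 := h4.fderiv
    rw [fderiv_apply (hdR z (hbD hz))] at h5
    have h6 := congrArg (fun T : ℂ →L[ℝ] ℂ => T v) h5
    simp only [ContinuousLinearMap.comp_apply, ContinuousLinearMap.proj_apply] at h6
    rw [h6]
    simp [mul_comm]
  have hlin : ∀ z ∈ ball c R, (IsComplexLinear (fderiv ℝ f z) ↔ ∀ j, deriv (B j) z = 0) := by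
    intro z hz
    constructor
    · intro H j
      have h1 := congrFun (H 1) j
      simp only [Pi.smul_apply, hder z hz, smul_eq_mul, mul_one, map_mul, conj_I] at h1
      have h2 : I * starRingEnd ℂ (deriv (B j) z) = 0 := by linear_combination (-1 / 2) * h1
      simpa using h2
    · intro H v
      ext j
      simp only [Pi.smul_apply, hder z hz, H j, smul_eq_mul, zero_mul, map_zero]
      ring
  have hanti : ∀ z ∈ ball c R, (IsComplexAntilinear (fderiv ℝ f z) ↔ ∀ j, deriv (A j) z = 0) := by
    intro z hz
    constructor
    · intro H j
      have h1 := congrFun (H 1) j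
      simp only [Pi.smul_apply, Pi.neg_apply, hder z hz, smul_eq_mul, mul_one, map_mul,
        conj_I] at h1
      have h2 : I * deriv (A j) z = 0 := by linear_combination (1 / 2) * h1
      simpa using h2
    · intro H v
      ext j
      simp only [Pi.smul_apply, Pi.neg_apply, hder z hz, H j, smul_eq_mul, zero_mul, map_mul,
        conj_I]
      ring
  have hAan : ∀ j, AnalyticOnNhd ℂ (deriv (A j)) (ball c R) := fun j =>
    ((hA j).deriv isOpen_ball).analyticOnNhd isOpen_ball
  have hBan : ∀ j, AnalyticOnNhd ℂ (deriv (B j)) (ball c R) := fun j =>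
    ((hB j).deriv isOpen_ball).analyticOnNhd isOpen_ball
  have hpre : IsPreconnected (ball c R) := (convex_ball c R).isPreconnected
  constructor
  · by_contra! hcon
    obtain ⟨hL, hA'⟩ := hcon
    obtain ⟨a, ha, haL⟩ := not_subset.1 hL
    obtain ⟨b, hb, hbA⟩ := not_subset.1 hA'
    rw [mem_ofPred_eq, hlin a ha] at haL
    rw [mem_ofPred_eq, hanti b hb] at hbA
    push Not at haL hbA
    obtain ⟨i, hi⟩ := haL
    obtain ⟨j, hj⟩ := hbA
    rcases (hBan i).eq_zero_or_eq_zero_of_mul_eq_zero (hAan j) (fun z hz => by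
      rcases h z (hbD hz) with H | H
      · rw [(hlin z hz).1 H i, zero_mul]
      · rw [(hanti z hz).1 H j, mul_zero]) hpre with H | H
    · exact hi (H a ha)
    · exact hj (H b hb)
  · rintro W hWo ⟨w, hw⟩ hWb hWLA z hz
    have hev : ∀ᶠ x in 𝓝 w, x ∈ W := hWo.mem_nhds hw
    constructor
    · refine (hlin z hz).2 fun j => ?_
      refine (hBan j).eqOn_zero_of_preconnected_of_eventuallyEq_zero hpre (hWb hw) ?_ hz
      filter_upwards [hev] with x hx
      exact (hlin x (hWb hx)).1 (hWLA hx).1 j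
    · refine (hanti z hz).2 fun j => ?_
      refine (hAan j).eqOn_zero_of_preconnected_of_eventuallyEq_zero hpre (hWb hw) ?_ hz
      filter_upwards [hev] with x hx
      exact (hanti x (hWb hx)).1 (hWLA hx).2 j

/-- The dichotomy on a domain of the complex plane. -/
lemma rigidDichotomy_of_isPreconnected_complex {m : ℕ} {D : Set ℂ} (hDo : IsOpen D)
    (hc : IsPreconnected D) {f : ℂ → Fin m → ℂ} (hf : ContDiffOn ℝ 1 f D)
    (h : ∀ z ∈ D, IsComplexLinear (fderiv ℝ f z) ∨ IsComplexAntilinear (fderiv ℝ f z)) :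
    RigidDichotomy {z | IsComplexLinear (fderiv ℝ f z)} {z | IsComplexAntilinear (fderiv ℝ f z)}
      D := by
  refine .of_local hc fun p hp => ?_
  obtain ⟨R, hR, hsub⟩ := nhds_basis_closedBall.mem_iff.1 (hDo.mem_nhds hp)
  exact ⟨ball p R, isOpen_ball, mem_ball_self hR, rigidDichotomy_ball hR hDo hsub hf h⟩

section Slices

variable {E : Type*} [NormedAddCommGroup E] [NormedSpace ℂ E]

lemma exists_mem_apply_sub_ne_zero {F : Type*} [NormedAddCommGroup F] [NormedSpace ℝ F]
    {T : E →L[ℝ] F} (hT : T ≠ 0) {W : Set E} (hWo : IsOpen W) (hW : W.Nonempty) (q : E) :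
    ∃ w ∈ W, T (w - q) ≠ 0 := by
  by_contra! hcon
  obtain ⟨w, hw⟩ := hW
  have h1 : HasFDerivAt (fun x => T (x - q)) T w := T.hasFDerivAt.comp w (hasFDerivAt_sub_const q)
  have h2 : HasFDerivAt (fun x => T (x - q)) (0 : E →L[ℝ] F) w :=
    (hasFDerivAt_const (0 : F) w).congr_of_eventuallyEq
      (by filter_upwards [hWo.mem_nhds hw] with x hx using hcon x hx)
  exact hT (h1.unique h2)

/-- The dichotomy for the restriction of a map to a complex line. -/
lemma rigidDichotomy_slice {m : ℕ} {B : Set E} (hBo : IsOpen B) (hBc : Convex ℝ B)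
    {f : E → Fin m → ℂ} (hf : ContDiffOn ℝ 1 f B)
    (h : ∀ z ∈ B, IsComplexLinear (fderiv ℝ f z) ∨ IsComplexAntilinear (fderiv ℝ f z)) (a v : E) :
    RigidDichotomy {t : ℂ | ∀ s : ℂ, fderiv ℝ f (a + t • v) ((I * s) • v)
        = I • fderiv ℝ f (a + t • v) (s • v)}
      {t : ℂ | ∀ s : ℂ, fderiv ℝ f (a + t • v) ((I * s) • v)
        = -(I • fderiv ℝ f (a + t • v) (s • v))} {t : ℂ | a + t • v ∈ B} := by
  set ℓ : ℂ → E := fun t => a + t • v with hℓ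
  have hSo : IsOpen (ℓ ⁻¹' B) := hBo.preimage (by fun_prop)
  have hSc : Convex ℝ (ℓ ⁻¹' B) := by
    intro x hx y hy α β hα hβ hαβ
    have := hBc hx hy hα hβ hαβ
    have heq : ℓ (α • x + β • y) = α • ℓ x + β • ℓ y := by
      simp only [hℓ, add_smul, smul_add, smul_assoc]
      rw [add_add_add_comm, ← add_smul, hαβ, one_smul]
    rwa [mem_preimage, heq]
  have hder : ∀ t ∈ ℓ ⁻¹' B, ∀ s : ℂ, fderiv ℝ (f ∘ ℓ) t s = fderiv ℝ f (ℓ t) (s • v) := by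
    intro t ht s
    have h1 : HasFDerivAt ℓ (((1 : ℂ →L[ℂ] ℂ).smulRight v).restrictScalars ℝ) t :=
      (((hasFDerivAt_id t).smul_const v).const_add a).restrictScalars ℝ
    have h2 : HasFDerivAt f (fderiv ℝ f (ℓ t)) (ℓ t) :=
      ((hf.differentiableOn one_ne_zero).differentiableAt (hBo.mem_nhds ht)).hasFDerivAt
    rw [(h2.comp t h1).fderiv]
    simp
  have hℓc : ContDiff ℝ 1 ℓ := contDiff_const.add (contDiff_id.smul contDiff_const)
  have hmain := rigidDichotomy_of_isPreconnected_complex hSo hSc.isPreconnected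
    (f := f ∘ ℓ) (hf.comp hℓc.contDiffOn fun t ht => ht) (fun t ht => by
      refine (h (ℓ t) ht).imp (fun H s => ?_) (fun H s => ?_)
      · rw [hder t ht, hder t ht, smul_eq_mul, mul_smul, H]
      · rw [hder t ht, hder t ht, smul_eq_mul, mul_smul, H])
  have hL : ∀ t ∈ ℓ ⁻¹' B, (IsComplexLinear (fderiv ℝ (f ∘ ℓ) t) ↔
      ∀ s : ℂ, fderiv ℝ f (ℓ t) ((I * s) • v) = I • fderiv ℝ f (ℓ t) (s • v)) := by
    intro t ht
    simp only [IsComplexLinear, hder t ht, smul_eq_mul]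
  have hA : ∀ t ∈ ℓ ⁻¹' B, (IsComplexAntilinear (fderiv ℝ (f ∘ ℓ) t) ↔
      ∀ s : ℂ, fderiv ℝ f (ℓ t) ((I * s) • v) = -(I • fderiv ℝ f (ℓ t) (s • v))) := by
    intro t ht
    simp only [IsComplexAntilinear, hder t ht, smul_eq_mul]
  refine ⟨hmain.1.imp (fun H t ht => (hL t ht).1 (H ht)) (fun H t ht => (hA t ht).1 (H ht)), ?_⟩
  intro W hWo hWne hWS hW t ht
  have := hmain.2 W hWo hWne hWS
    (fun x hx => ⟨(hL x (hWS hx)).2 (hW hx).1, (hA x (hWS hx)).2 (hW hx).2⟩) ht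
  exact ⟨(hL t ht).1 this.1, (hA t ht).1 this.2⟩

/-- The dichotomy on a convex open set. -/
lemma rigidDichotomy_of_convex {m : ℕ} {B : Set E} (hBo : IsOpen B) (hBc : Convex ℝ B)
    {f : E → Fin m → ℂ} (hf : ContDiffOn ℝ 1 f B)
    (h : ∀ z ∈ B, IsComplexLinear (fderiv ℝ f z) ∨ IsComplexAntilinear (fderiv ℝ f z)) :
    RigidDichotomy {z | IsComplexLinear (fderiv ℝ f z)} {z | IsComplexAntilinear (fderiv ℝ f z)}
      B := by
  have hfd : ContinuousOn (fderiv ℝ f) B := hf.continuousOn_fderiv_of_isOpen hBo le_rfl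
  constructor
  · by_contra! hcon
    obtain ⟨a, ha, haL⟩ := not_subset.1 hcon.1
    obtain ⟨b, hb, hbA⟩ := not_subset.1 hcon.2
    have hne : ∀ {T : E →L[ℝ] Fin m → ℂ}, ¬ IsComplexLinear T → T ≠ 0 := by
      rintro T hT rfl
      exact hT fun v => by simp
    have hne' : ∀ {T : E →L[ℝ] Fin m → ℂ}, ¬ IsComplexAntilinear T → T ≠ 0 := by
      rintro T hT rfl
      exact hT fun v => by simp
    obtain ⟨b', ⟨hb', hb'A⟩, hb'a⟩ := exists_mem_apply_sub_ne_zero (hne haL)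
      (hfd.isOpen_inter_preimage hBo
        (isClosed_setOf_isComplexAntilinear (E := E) (F := Fin m → ℂ)).isOpen_compl) ⟨b, hb, hbA⟩ a
    have ho1 := hfd.isOpen_inter_preimage hBo
      (isClosed_setOf_isComplexLinear (E := E) (F := Fin m → ℂ)).isOpen_compl
    have hev : ContinuousOn (fun x => fderiv ℝ f x (b' - x)) B := hfd.clm_apply (by fun_prop)
    have ho2 := hev.isOpen_inter_preimage hBo (isOpen_compl_singleton (x := (0 : Fin m → ℂ)))
    obtain ⟨a', ⟨⟨ha', ha'L⟩, -, ha'b⟩, hb'a'⟩ := exists_mem_apply_sub_ne_zero (hne' hb'A)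
      (ho1.inter ho2) ⟨a, ⟨ha, haL⟩, ha, hb'a⟩ b'
    have ha'A := (h a' ha').resolve_left ha'L
    have hb'L := (h b' hb').resolve_right hb'A
    have hself : ∀ {y : Fin m → ℂ}, I • y = -(I • y) → y = 0 := by
      intro y hy
      rw [eq_neg_iff_add_eq_zero, ← two_smul ℂ] at hy
      simpa using hy
    rcases (rigidDichotomy_slice hBo hBc hf h a' (b' - a')).1 with H | H
    · have h1 := H (show (0 : ℂ) ∈ {t : ℂ | a' + t • (b' - a') ∈ B} by simpa using ha') 1
      rw [mul_smul, zero_smul, add_zero, one_smul, ha'A] at h1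
      exact ha'b (hself h1.symm)
    · have h1 := H (show (1 : ℂ) ∈ {t : ℂ | a' + t • (b' - a') ∈ B} by simpa using hb') 1
      rw [mul_smul, one_smul, add_sub_cancel, hb'L] at h1
      refine hb'a' ?_
      rw [← neg_sub, map_neg, hself h1, neg_zero]
  · rintro W hWo hWne hWB hW q hq
    by_contra hqn
    have hT : fderiv ℝ f q ≠ 0 := by
      intro h0
      exact hqn ⟨fun v => by simp [h0], fun v => by simp [h0]⟩
    obtain ⟨w, hw, hTw⟩ := exists_mem_apply_sub_ne_zero hT hWo hWne q
    have hs := (rigidDichotomy_slice hBo hBc hf h q (w - q)).2 {t | q + t • (w - q) ∈ W}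
      (hWo.preimage (by fun_prop)) ⟨1, by simpa using hw⟩ (fun t ht => hWB ht)
      (fun t ht => ⟨fun s => by rw [mul_smul, (hW ht).1], fun s => by rw [mul_smul, (hW ht).2]⟩)
    have h0 := hs (show (0 : ℂ) ∈ {t : ℂ | q + t • (w - q) ∈ B} by simpa using hq)
    have h1 := h0.1 1
    rw [h0.2 1] at h1
    simp only [zero_smul, add_zero, one_smul] at h1
    rw [neg_eq_iff_add_eq_zero, ← two_smul ℂ] at h1
    exact hTw (by simpa using h1)

end Slices

/-- A `C¹` map on a domain `D ⊆ ℂⁿ` whose real Fréchet derivative at each point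
is either ℂ-linear or ℂ-antilinear is holomorphic or antiholomorphic on `D`. -/
theorem stmt_7 (n m : ℕ) (D : Set (Fin n → ℂ)) (hDo : IsOpen D)
    (hDne : D.Nonempty) (hDconn : IsConnected D)
    (f : (Fin n → ℂ) → (Fin m → ℂ))
    (hf : ContDiffOn ℝ 1 f D)
    (h : ∀ p ∈ D,
      (∀ v : Fin n → ℂ, fderiv ℝ f p (Complex.I • v) = Complex.I • fderiv ℝ f p v) ∨
      (∀ v : Fin n → ℂ, fderiv ℝ f p (Complex.I • v) = -(Complex.I • fderiv ℝ f p v))) :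
    DifferentiableOn ℂ f D ∨
    DifferentiableOn ℂ (fun z => fun j => starRingEnd ℂ (f z j)) D := by
  have hd : ∀ p ∈ D, DifferentiableAt ℝ f p := fun p hp =>
    (hf.differentiableOn one_ne_zero).differentiableAt (hDo.mem_nhds hp)
  have hmain : RigidDichotomy {z | IsComplexLinear (fderiv ℝ f z)}
      {z | IsComplexAntilinear (fderiv ℝ f z)} D := by
    refine .of_local hDconn.isPreconnected fun p hp => ?_
    obtain ⟨R, hR, hsub⟩ := nhds_basis_ball.mem_iff.1 (hDo.mem_nhds hp)
    exact ⟨ball p R, isOpen_ball, mem_ball_self hR, rigidDichotomy_of_convex isOpen_ball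
      (convex_ball p R) (hf.mono hsub) fun z hz => h z (hsub hz)⟩
  refine hmain.1.imp (fun H p hp => ?_) (fun H p hp => ?_)
  · exact (IsComplexLinear.differentiableAt (hd p hp) (H hp)).differentiableWithinAt
  · refine DifferentiableAt.differentiableWithinAt (differentiableAt_pi.2 fun j => ?_)
    refine IsComplexLinear.differentiableAt
      (conjCLE.differentiableAt.comp p (differentiableAt_pi.1 (hd p hp) j)) ?_
    rw [fderiv_conj_comp, fderiv_apply (hd p hp), IsComplexLinear.conj_comp_iff]
    exact fun v => congrFun (H hp v) j
end
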